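/- Let K ⊂ H⁺(y₀)×X be an isolated invariant set admitting a strongly admissible isolating neighborhood, let (A,R) be an attractor–repeller decomposition of K, and let (N₁,N₂,N₃) and (M₁,M₂,M₃) be index triples for (y₀,K,A,R). Then there exist T > 0 and an index triple (L₁,L₂,L₃) for (y₀,K,A,R) such that L₁ ⊂ N₁ ∩ M₁, L₂ ⊂ N₂^{−T}(N₁) ∩ M₂^{−T}(M₁), and L₃ ⊂ N₃^{−T}(N₁) ∩ M₃^{−T}(M₁). -/

import Mathlib

open Filter Topology Set
open scoped NNReal ENNReal

noncomputable section

/-- A partial semiflow on a topological space `Z`. The value `none` plays the role of the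
symbol `◊` ("undefined").  Time is modelled by `ℝ≥0`. -/
structure PartialSemiflow (Z : Type*) [TopologicalSpace Z] where
  /-- The (partially defined) flow map. -/
  flow : ℝ≥0 → Z → Option Z
  /-- The domain of definition is open in `[0,∞) × Z`. -/
  isOpen_dom : IsOpen {p : ℝ≥0 × Z | (flow p.1 p.2).isSome = true}
  /-- The flow is continuous on its domain of definition. -/
  continuous_flow : ∀ V : Set Z, IsOpen V →
    IsOpen {p : ℝ≥0 × Z | ∃ z ∈ V, flow p.1 p.2 = some z}
  /-- `z π 0 = z`. -/
  flow_zero : ∀ z, flow 0 z = some z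
  /-- The semigroup property; `◊ π t = ◊` is built into `Option.bind`. -/
  flow_add : ∀ (t₁ t₂ : ℝ≥0) (z : Z), flow (t₁ + t₂) z = (flow t₁ z).bind (flow t₂)

namespace PartialSemiflow

variable {Z : Type*} [TopologicalSpace Z] (π : PartialSemiflow Z)

/-- `π.mem t z M` means: `z π t` is defined and belongs to `M`. -/
def mem (t : ℝ≥0) (z : Z) (M : Set Z) : Prop := ∃ w ∈ M, π.flow t z = some w

/-- `π.segMem t z M` means `z π [0,t] ⊆ M`. -/
def segMem (t : ℝ≥0) (z : Z) (M : Set Z) : Prop := ∀ s ≤ t, π.mem s z M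

/-- A full solution `u : ℝ → Z` of the semiflow. -/
def IsSolution (u : ℝ → Z) : Prop :=
  ∀ (t₀ : ℝ) (s : ℝ≥0), π.flow s (u t₀) = some (u (t₀ + (s : ℝ)))

/-- The largest invariant subset of `N`. -/
def Inv (N : Set Z) : Set Z :=
  {z | ∃ u : ℝ → Z, π.IsSolution u ∧ (∀ t, u t ∈ N) ∧ u 0 = z}

/-- The largest negatively invariant subset of `N` (solutions on `(-∞,0]`). -/
def InvMinus (N : Set Z) : Set Z :=
  {z | ∃ u : ℝ → Z, (∀ t ≤ (0 : ℝ), u t ∈ N) ∧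
    (∀ (t₀ : ℝ) (s : ℝ≥0), t₀ + (s : ℝ) ≤ 0 → π.flow s (u t₀) = some (u (t₀ + (s : ℝ)))) ∧
    u 0 = z}

/-- Strong admissibility of a set `M`: asymptotic compactness together with
non-explosion of the semiflow in `M`. -/
def StronglyAdmissible (M : Set Z) : Prop :=
  (∀ (z : ℕ → Z) (t : ℕ → ℝ≥0),
      (∀ n, π.segMem (t n) (z n) M) →
      ∃ w : ℕ → Z, (∀ n, π.flow (t n) (z n) = some (w n)) ∧
        ∃ φ : ℕ → ℕ, StrictMono φ ∧ ∃ l : Z, Tendsto (w ∘ φ) atTop (nhds l)) ∧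
  (∀ (z : Z) (t : ℝ≥0), (∀ s < t, ∃ w ∈ M, π.flow s z = some w) → (π.flow t z).isSome)

end PartialSemiflow

/-- A global (everywhere defined) semiflow on `Y`, the "translation" `y ↦ y^t`. -/
structure GlobalSemiflow (Y : Type*) [TopologicalSpace Y] where
  /-- The translation map. -/
  trans : ℝ≥0 → Y → Y
  continuous_trans : Continuous fun p : ℝ≥0 × Y => trans p.1 p.2
  trans_zero : ∀ y, trans 0 y = y
  trans_add : ∀ (s t : ℝ≥0) (y : Y), trans (s + t) y = trans t (trans s y)

variable {X Y : Type*} [MetricSpace X] [MetricSpace Y]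

/-- `π` is a skew-product semiflow over the translation semiflow `σ`:  whenever
`(y,x) π t` is defined, its first component is `y^t`. -/
def GlobalSemiflow.IsSkewProduct (σ : GlobalSemiflow Y) (π : PartialSemiflow (Y × X)) : Prop :=
  ∀ (t : ℝ≥0) (y : Y) (x : X) (w : Y × X), π.flow t (y, x) = some w → w.1 = σ.trans t y

/-- The positive hull `H⁺(y₀)` of `y₀`. -/
def hullPlus (σ : GlobalSemiflow Y) (y₀ : Y) : Set Y :=
  closure {y | ∃ t : ℝ≥0, σ.trans t y₀ = y}

/-- The space `H⁺(y₀) × X`, as a subset of `Y × X`. -/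
def extSpace (σ : GlobalSemiflow Y) (y₀ : Y) : Set (Y × X) :=
  (hullPlus σ y₀) ×ˢ (Set.univ : Set X)

/-- The map `r = r_{y₀} : [0,∞) × X → H⁺(y₀) × X`, `r(t,x) = (y₀^t, x)`. -/
def rMap (σ : GlobalSemiflow Y) (y₀ : Y) : ℝ≥0 × X → Y × X :=
  fun p => (σ.trans p.1 y₀, p.2)

/-- The canonical semiflow `χ = χ_{y₀}` on `[0,∞) × X`:
`(t,x) χ s = (t+s, Φ(s, y₀^t, x))`. -/
def chi (σ : GlobalSemiflow Y) (π : PartialSemiflow (Y × X)) (y₀ : Y)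
    (s : ℝ≥0) (p : ℝ≥0 × X) : Option (ℝ≥0 × X) :=
  (π.flow s (σ.trans p.1 y₀, p.2)).map fun w => (p.1 + s, w.2)

/-- `chiMem σ π y₀ s p M` means: `p χ s` is defined and belongs to `M`. -/
def chiMem (σ : GlobalSemiflow Y) (π : PartialSemiflow (Y × X)) (y₀ : Y)
    (s : ℝ≥0) (p : ℝ≥0 × X) (M : Set (ℝ≥0 × X)) : Prop :=
  ∃ q ∈ M, chi σ π y₀ s p = some q

/-- `N` is an isolating neighborhood for `K` in `H⁺(y₀) × X`. -/
def IsIsolatingNbhd (σ : GlobalSemiflow Y) (π : PartialSemiflow (Y × X)) (y₀ : Y)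
    (K N : Set (Y × X)) : Prop :=
  N ⊆ extSpace σ y₀ ∧ IsClosed N ∧
  (∀ z ∈ π.Inv N, N ∈ nhdsWithin z (extSpace σ y₀)) ∧ K = π.Inv N

/-- `W` is a neighborhood of `K` in `H⁺(y₀) × X`. -/
def IsNbhdOfIn (σ : GlobalSemiflow Y) (y₀ : Y) (K W : Set (Y × X)) : Prop :=
  W ⊆ extSpace σ y₀ ∧ ∀ z ∈ K, W ∈ nhdsWithin z (extSpace (X := X) σ y₀)

/-- A basic index pair in `[0,∞) × X` relative to the semiflow `χ_{y₀}`. -/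
structure IsBasicIndexPair (σ : GlobalSemiflow Y) (π : PartialSemiflow (Y × X)) (y₀ : Y)
    (N₁ N₂ : Set (ℝ≥0 × X)) : Prop where
  subset : N₂ ⊆ N₁
  closed₁ : IsClosed N₁
  closed₂ : IsClosed N₂
  ip2 : ∀ p ∈ N₁, ∀ t : ℝ≥0, ¬ chiMem σ π y₀ t p N₁ → ∃ s ≤ t, chiMem σ π y₀ s p N₂
  ip3 : ∀ p ∈ N₂, ∀ t : ℝ≥0, ¬ chiMem σ π y₀ t p N₂ → ∃ s ≤ t, ¬ chiMem σ π y₀ s p N₁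

/-- An index pair for `(y₀, K)`. -/
structure IsIndexPair (σ : GlobalSemiflow Y) (π : PartialSemiflow (Y × X)) (y₀ : Y)
    (K : Set (Y × X)) (N₁ N₂ : Set (ℝ≥0 × X)) : Prop where
  toBasic : IsBasicIndexPair σ π y₀ N₁ N₂
  ip4 : ∃ N : Set (Y × X), IsIsolatingNbhd σ π y₀ K N ∧ π.StronglyAdmissible N ∧
    N₁ \ N₂ ⊆ rMap σ y₀ ⁻¹' N
  ip5 : ∃ W : Set (Y × X), IsNbhdOfIn σ y₀ K W ∧ rMap σ y₀ ⁻¹' W ⊆ N₁ \ N₂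

/-- `N₂^{-T}(N₁) = {p ∈ N₁ : p χ s ∈ N₂ for some s ∈ [0,T]}`. -/
def backSet (σ : GlobalSemiflow Y) (π : PartialSemiflow (Y × X)) (y₀ : Y)
    (N₁ N₂ : Set (ℝ≥0 × X)) (T : ℝ≥0) : Set (ℝ≥0 × X) :=
  {p ∈ N₁ | ∃ s ≤ T, chiMem σ π y₀ s p N₂}


/-- The relation identifying all points of `A ∩ B`, together with an extra point
(which serves as the class `[B]` even when `A ∩ B = ∅`). -/
def quotRel {Z : Type*} (A B : Set Z) : ↥A ⊕ Unit → ↥A ⊕ Unit → Prop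
  | Sum.inl a, Sum.inl b => a = b ∨ ((a : Z) ∈ B ∧ (b : Z) ∈ B)
  | Sum.inl a, Sum.inr _ => (a : Z) ∈ B
  | Sum.inr _, Sum.inl b => (b : Z) ∈ B
  | Sum.inr _, Sum.inr _ => True

/-- The pointed quotient space `A/B`. -/
def PtdQuot {Z : Type*} [TopologicalSpace Z] (A B : Set Z) : Type _ := Quot (quotRel A B)

instance {Z : Type*} [TopologicalSpace Z] (A B : Set Z) : TopologicalSpace (PtdQuot A B) :=
  inferInstanceAs (TopologicalSpace (Quot _))

/-- The base point `[B]` of `A/B`. -/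
def PtdQuot.pt {Z : Type*} [TopologicalSpace Z] (A B : Set Z) : PtdQuot A B :=
  Quot.mk _ (Sum.inr ())

/-- `f : (Z, z₀) → (W, w₀)` is a pointed homotopy equivalence. -/
def IsPointedHomotopyEquiv {Z W : Type*} [TopologicalSpace Z] [TopologicalSpace W]
    (z₀ : Z) (w₀ : W) (f : C(Z, W)) : Prop :=
  f z₀ = w₀ ∧ ∃ g : C(W, Z), g w₀ = z₀ ∧
    Nonempty (ContinuousMap.HomotopyRel (g.comp f) (ContinuousMap.id Z) {z₀}) ∧
    Nonempty (ContinuousMap.HomotopyRel (f.comp g) (ContinuousMap.id W) {w₀})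

/-- There is a pointed homotopy equivalence `(Z,z₀) → (W,w₀)`. -/
def PointedHomotopyEquivalent {Z W : Type*} [TopologicalSpace Z] [TopologicalSpace W]
    (z₀ : Z) (w₀ : W) : Prop :=
  ∃ f : C(Z, W), IsPointedHomotopyEquiv z₀ w₀ f

variable {X Y : Type*} [MetricSpace X] [MetricSpace Y]

/-- `g⁺(z) = sup{t ≥ 0 : z π [0,t] ⊆ U}`, with `sup ∅ = 0`, valued in `[0,∞]`. -/
def gPlus (π : PartialSemiflow (Y × X)) (U : Set (Y × X)) (z : Y × X) : ℝ≥0∞ :=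
  ⨆ t ∈ {t : ℝ≥0 | π.segMem t z U}, (t : ℝ≥0∞)

/-- `g⁻(z) = sup{d(z π t, Inv⁻(N)) : t ∈ [0, g⁺(z)], z π t ≠ ◊}`, with `sup ∅ = 0`
and `d(·,∅) = ∞`, valued in `[0,∞]`. -/
def gMinus (π : PartialSemiflow (Y × X)) (U N : Set (Y × X)) (z : Y × X) : ℝ≥0∞ :=
  ⨆ t ∈ {t : ℝ≥0 | (t : ℝ≥0∞) ≤ gPlus π U z},
    ⨆ w ∈ {w : Y × X | π.flow t z = some w}, EMetric.infEdist w (π.InvMinus N)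

/-- The function `f(p) = sup{t₀ ≥ 0 : p χ s ∈ cl(N₁ \ N₂) for all s ∈ [0,t₀]}`,
with `sup ∅ = 0`, valued in `[0,∞]`. -/
def fTime (σ : GlobalSemiflow Y) (π : PartialSemiflow (Y × X)) (y₀ : Y)
    (N₁ N₂ : Set (ℝ≥0 × X)) (p : ℝ≥0 × X) : ℝ≥0∞ :=
  ⨆ t₀ ∈ {t₀ : ℝ≥0 | ∀ s ≤ t₀, chiMem σ π y₀ s p (closure (N₁ \ N₂))}, (t₀ : ℝ≥0∞)

/-- The α-limit set of a full solution `u`. -/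
def solAlphaLimit (u : ℝ → Y × X) : Set (Y × X) := ⋂ t : ℝ, closure (u '' Set.Iic t)

/-- The ω-limit set of a full solution `u`. -/
def solOmegaLimit (u : ℝ → Y × X) : Set (Y × X) := ⋂ t : ℝ, closure (u '' Set.Ici t)

/-- `(A, R)` is an attractor-repeller decomposition of the isolated invariant set `K`. -/
structure IsARDecomp (σ : GlobalSemiflow Y) (π : PartialSemiflow (Y × X)) (y₀ : Y)
    (K A R : Set (Y × X)) : Prop where
  A_subset : A ⊆ K
  R_subset : R ⊆ K
  disjoint : Disjoint A R
  A_isolated : ∃ N, IsIsolatingNbhd σ π y₀ A N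
  R_isolated : ∃ N, IsIsolatingNbhd σ π y₀ R N
  alternatives : ∀ u : ℝ → Y × X, π.IsSolution u → (∀ t, u t ∈ K) →
    (∀ t, u t ∈ A) ∨ (∀ t, u t ∈ R) ∨ (solAlphaLimit u ⊆ R ∧ solOmegaLimit u ⊆ A)

/-- An index triple for `(y₀, K, A, R)`. -/
structure IsIndexTriple (σ : GlobalSemiflow Y) (π : PartialSemiflow (Y × X)) (y₀ : Y)
    (K A R : Set (Y × X)) (N₁ N₂ N₃ : Set (ℝ≥0 × X)) : Prop where
  sub32 : N₃ ⊆ N₂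
  sub21 : N₂ ⊆ N₁
  pairK : IsIndexPair σ π y₀ K N₁ N₃
  pairA : IsIndexPair σ π y₀ A N₂ N₃

/-- An FM-index pair for `K` relative to `π`, restricted to `H⁺(y₀) × X`. -/
structure IsFMIndexPair (σ : GlobalSemiflow Y) (π : PartialSemiflow (Y × X)) (y₀ : Y)
    (K N₁ N₂ : Set (Y × X)) : Prop where
  subset : N₂ ⊆ N₁
  sub_ext : N₁ ⊆ extSpace σ y₀
  closed₁ : IsClosed N₁
  closed₂ : IsClosed N₂
  isolating : IsIsolatingNbhd σ π y₀ K (closure (N₁ \ N₂))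
  interior_K : ∀ z ∈ K, N₁ \ N₂ ∈ nhdsWithin z (extSpace σ y₀)
  posInv : ∀ z ∈ N₂, ∀ t : ℝ≥0, (∀ s ≤ t, π.mem s z N₁) → ∀ s ≤ t, π.mem s z N₂
  exit : ∀ z ∈ N₁, ∀ t : ℝ≥0, ¬ π.mem t z N₁ →
    ∃ s ≤ t, (∀ s' ≤ s, π.mem s' z N₁) ∧ π.mem s z N₂


namespace PartialSemiflow

section LimitLemmas

variable {Z : Type*} [MetricSpace Z] {π : PartialSemiflow Z}

lemma mem.mono {t : ℝ≥0} {z : Z} {M N : Set Z} (h : π.mem t z M) (hMN : M ⊆ N) :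
    π.mem t z N := by
  obtain ⟨w, hw, h⟩ := h
  exact ⟨w, hMN hw, h⟩

lemma segMem.mono {t : ℝ≥0} {z : Z} {M N : Set Z} (h : π.segMem t z M) (hMN : M ⊆ N) :
    π.segMem t z N := fun s hs => (h s hs).mono hMN

lemma mem_zero_iff {z : Z} {M : Set Z} : π.mem 0 z M ↔ z ∈ M := by
  simp [mem, π.flow_zero]

lemma mem_iff_of_flow {t : ℝ≥0} {z w : Z} {M : Set Z} (h : π.flow t z = some w) :
    π.mem t z M ↔ w ∈ M := by
  simp [mem, h]

lemma flow_add_of_flow {s t : ℝ≥0} {z w : Z} (h : π.flow s z = some w) :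
    π.flow (s + t) z = π.flow t w := by
  simp [π.flow_add, h]

lemma mem_add_iff {s t : ℝ≥0} {z w : Z} {M : Set Z} (h : π.flow s z = some w) :
    π.mem (s + t) z M ↔ π.mem t w M := by
  simp [mem, flow_add_of_flow h]

lemma segMem.shift {s t : ℝ≥0} {z w : Z} {M : Set Z} (h : π.segMem (s + t) z M)
    (hw : π.flow s z = some w) : π.segMem t w M := fun r hr =>
  (mem_add_iff hw).1 (h (s + r) (by gcongr))

lemma segMem.concat {s t : ℝ≥0} {z w : Z} {M : Set Z} (h : π.segMem s z M)
    (hw : π.flow s z = some w) (h' : π.segMem t w M) : π.segMem (s + t) z M := by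
  intro r hr
  rcases le_total r s with hrs | hsr
  · exact h r hrs
  · obtain ⟨c, rfl⟩ := exists_add_of_le hsr
    exact (mem_add_iff hw).2 (h' c (by simpa using hr))

lemma isOpen_setOf_mem {V : Set Z} (hV : IsOpen V) :
    IsOpen {p : ℝ≥0 × Z | π.mem p.1 p.2 V} := π.continuous_flow V hV

lemma isOpen_setOf_mem_time {V : Set Z} (hV : IsOpen V) (z : Z) :
    IsOpen {s : ℝ≥0 | π.mem s z V} :=
  (isOpen_setOf_mem (π := π) hV).preimage (by fun_prop : Continuous fun s : ℝ≥0 => (s, z))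

lemma isOpen_setOf_mem_point {V : Set Z} (hV : IsOpen V) (s : ℝ≥0) :
    IsOpen {z : Z | π.mem s z V} :=
  (isOpen_setOf_mem (π := π) hV).preimage (by fun_prop : Continuous fun z : Z => (s, z))

lemma isOpen_setOf_isSome_time (z : Z) : IsOpen {s : ℝ≥0 | (π.flow s z).isSome} :=
  π.isOpen_dom.preimage (by fun_prop : Continuous fun s : ℝ≥0 => (s, z))

lemma isOpen_setOf_segMem {V : Set Z} (hV : IsOpen V) (t : ℝ≥0) :
    IsOpen {z : Z | π.segMem t z V} := by
  rw [isOpen_iff_mem_nhds]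
  intro z hz
  have := (isCompact_Icc (a := (0 : ℝ≥0)) (b := t)).eventually_forall_of_forall_eventually
    (x₀ := z) (P := fun x s => π.mem s x V) (fun s hs => ?_)
  · filter_upwards [this] with x hx s hs using hx s ⟨zero_le, hs⟩
  · have hop : IsOpen {p : Z × ℝ≥0 | π.mem p.2 p.1 V} :=
      (isOpen_setOf_mem (π := π) hV).preimage continuous_swap
    exact hop.mem_nhds (hz s hs.2)

lemma tendsto_flow {ι : Type*} {l : Filter ι} {t : ι → ℝ≥0} {z w : ι → Z} {t₀ : ℝ≥0}
    {z₀ w₀ : Z} (ht : Tendsto t l (𝓝 t₀)) (hz : Tendsto z l (𝓝 z₀))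
    (h₀ : π.flow t₀ z₀ = some w₀) (hw : ∀ᶠ i in l, π.flow (t i) (z i) = some (w i)) :
    Tendsto w l (𝓝 w₀) := by
  rw [tendsto_nhds]
  intro V hV hwV
  have h1 : {p : ℝ≥0 × Z | π.mem p.1 p.2 V} ∈ 𝓝 (t₀, z₀) :=
    (isOpen_setOf_mem hV).mem_nhds ⟨w₀, hwV, h₀⟩
  filter_upwards [(ht.prodMk_nhds hz) h1, hw] with i hi hwi
  exact (mem_iff_of_flow hwi).1 hi

lemma StronglyAdmissible.mono {M N : Set Z} (h : π.StronglyAdmissible N) (hMN : M ⊆ N) :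
    π.StronglyAdmissible M :=
  ⟨fun z t hzt => h.1 z t fun n => (hzt n).mono hMN,
    fun z t hz => h.2 z t fun s hs => mem.mono (hz s hs) hMN⟩

/-- If orbit segments stay in a closed set without explosion, so does the limit segment. -/
lemma segMem_of_tendsto {ι : Type*} {l : Filter ι} [l.NeBot] {P : Set Z} (hP : IsClosed P)
    (hne : ∀ z t, (∀ s < t, π.mem s z P) → (π.flow t z).isSome) {z : ι → Z} {z₀ : Z}
    (hz : Tendsto z l (𝓝 z₀)) {t : ℝ≥0} (h : ∀ᶠ i in l, π.segMem t (z i) P) :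
    π.segMem t z₀ P := by
  have key : ∀ s ≤ t, (π.flow s z₀).isSome → π.mem s z₀ P := by
    intro s hs hd
    obtain ⟨w₀, hw₀⟩ := Option.isSome_iff_exists.1 hd
    by_contra hcon
    have hwP : w₀ ∈ Pᶜ := fun hh => hcon ⟨w₀, hh, hw₀⟩
    have h1 := (isOpen_setOf_mem_point (π := π) hP.isOpen_compl s).mem_nhds
      (show π.mem s z₀ Pᶜ from ⟨w₀, hwP, hw₀⟩)
    obtain ⟨i, hi, hi'⟩ := ((hz.eventually_mem h1).and h).exists
    obtain ⟨w, hw, hw'⟩ := hi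
    exact hw ((mem_iff_of_flow hw').1 (hi' s hs))
  suffices hd : ∀ s ≤ t, (π.flow s z₀).isSome from fun s hs => key s hs (hd s hs)
  by_contra! hcon
  obtain ⟨s, hst, hs⟩ := hcon
  set S := {s : ℝ≥0 | (π.flow s z₀).isSome}ᶜ
  have hS : IsClosed S := (isOpen_setOf_isSome_time z₀).isClosed_compl
  have hSne : S.Nonempty := ⟨s, hs⟩
  have hmem := hS.csInf_mem hSne (OrderBot.bddBelow S)
  have hle : sInf S ≤ s := csInf_le (OrderBot.bddBelow S) hs
  refine hmem (hne _ _ fun r hr => key r ((hr.le.trans hle).trans hst) ?_)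
  by_contra hr'
  exact not_le_of_gt hr (csInf_le (OrderBot.bddBelow S) hr')

/-- Exit lemma: an orbit leaving a closed set does so through a point outside `V`. -/
lemma exists_exit {C V : Set Z} (hC : IsClosed C) (hV : IsOpen V)
    (hne : ∀ z t, (∀ s < t, π.mem s z C) → (π.flow t z).isSome) {z : Z} {t : ℝ≥0}
    (hz : z ∈ C) (hVC : ∀ s, π.mem s z V → π.mem s z C) (ht : ¬ π.segMem t z C) :
    ∃ s ≤ t, ∃ w, π.flow s z = some w ∧ π.segMem s z C ∧ w ∉ V := by
  have h1 : ∃ s ≤ t, ¬ π.mem s z V := by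
    by_contra! hcon
    exact ht fun s hs => hVC s (hcon s hs)
  obtain ⟨s, hst, hs⟩ := h1
  set S := {s : ℝ≥0 | π.mem s z V}ᶜ
  have hS : IsClosed S := (isOpen_setOf_mem_time hV z).isClosed_compl
  have hmem : sInf S ∈ S := hS.csInf_mem ⟨s, hs⟩ (OrderBot.bddBelow S)
  have hlt : ∀ r < sInf S, π.mem r z C := by
    intro r hr
    by_contra hr'
    exact not_le_of_gt hr (csInf_le (OrderBot.bddBelow S) fun hh => hr' (hVC r hh))
  obtain ⟨w, hw⟩ := Option.isSome_iff_exists.1 (hne _ _ hlt)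
  have hwC : w ∈ C := by
    rcases eq_or_ne (sInf S) 0 with h0 | h0
    · rw [h0, π.flow_zero] at hw
      simp only [Option.some.injEq] at hw
      exact hw ▸ hz
    by_contra hcon
    have hnb := (isOpen_setOf_mem_time (π := π) hC.isOpen_compl z).mem_nhds
      (show π.mem (sInf S) z Cᶜ from ⟨w, hcon, hw⟩)
    obtain ⟨r, hr, hrI⟩ := exists_Ioc_subset_of_mem_nhds hnb ⟨0, pos_iff_ne_zero.2 h0⟩
    obtain ⟨q, hq1, hq2⟩ := exists_between hr
    obtain ⟨x, hx, hx'⟩ := hrI ⟨hq1, hq2.le⟩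
    exact hx ((mem_iff_of_flow hx').1 (hlt q hq2))
  refine ⟨sInf S, (csInf_le (OrderBot.bddBelow S) hs).trans hst, w, hw, ?_,
    fun hwV => hmem ⟨w, hwV, hw⟩⟩
  intro r hr
  rcases hr.lt_or_eq with hr | rfl
  · exact hlt r hr
  · exact ⟨w, hwC, hw⟩

lemma isCompact_closure_of_subseq {S : Set Z}
    (h : ∀ x : ℕ → Z, (∀ n, x n ∈ S) →
      ∃ φ : ℕ → ℕ, StrictMono φ ∧ ∃ l, Tendsto (x ∘ φ) atTop (𝓝 l)) :
    IsCompact (closure S) := by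
  apply IsSeqCompact.isCompact
  intro x hx
  have : ∀ n : ℕ, ∃ y ∈ S, dist (x n) y < 1 / ((n : ℝ) + 1) := fun n =>
    Metric.mem_closure_iff.1 (hx n) _ Nat.one_div_pos_of_nat
  choose y hyS hxy using this
  obtain ⟨φ, hφ, l, hl⟩ := h y hyS
  have hd : Tendsto (fun n => dist (x n) (y n)) atTop (𝓝 0) :=
    squeeze_zero (fun _ => dist_nonneg) (fun n => (hxy n).le)
      tendsto_one_div_add_atTop_nhds_zero_nat
  have hl' : Tendsto (x ∘ φ) atTop (𝓝 l) :=
    (tendsto_iff_of_dist (hd.comp hφ.tendsto_atTop)).2 hl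
  exact ⟨l, isClosed_closure.mem_of_tendsto hl' (Eventually.of_forall fun n => hx _), φ, hφ, hl'⟩

/-- Admissibility, in ultrafilter form. -/
lemma StronglyAdmissible.exists_tendsto {N : Set Z} (hN : π.StronglyAdmissible N)
    (hNc : IsClosed N) (𝒰 : Ultrafilter ℕ) {y : ℕ → Z} {t : ℕ → ℝ≥0}
    (h : ∀ n, π.segMem (t n) (y n) N) :
    ∃ w : ℕ → Z, (∀ n, π.flow (t n) (y n) = some (w n)) ∧
      ∃ l ∈ N, Tendsto w 𝒰 (𝓝 l) := by
  choose w hwN hw using fun n => h n (t n) le_rfl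
  refine ⟨w, hw, ?_⟩
  have hc : IsCompact (closure (range w)) := by
    apply isCompact_closure_of_subseq
    intro x hx
    choose k hk using hx
    obtain ⟨w', hw', φ, hφ, l, hl⟩ := hN.1 (y ∘ k) (t ∘ k) fun n => h (k n)
    have : w' = x := by
      ext1 n
      have h1 := hw' n
      simp only [Function.comp, hw, hk, Option.some.injEq] at h1
      exact h1.symm
    exact ⟨φ, hφ, l, this ▸ hl⟩
  obtain ⟨l, -, hl⟩ := isCompact_iff_ultrafilter_le_nhds.1 hc (𝒰.map w)
    (le_principal_iff.2 (Ultrafilter.mem_coe.2 (Ultrafilter.mem_map.2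
      (Filter.univ_mem' fun n => subset_closure (mem_range_self n)))))
  exact ⟨l, hNc.mem_of_tendsto (show Tendsto w 𝒰 (𝓝 l) from hl) (Eventually.of_forall hwN), hl⟩

/-- Limits of endpoints of longer and longer orbit segments admit backward solutions. -/
lemma StronglyAdmissible.exists_backward {N : Set Z} (hN : π.StronglyAdmissible N)
    (hNc : IsClosed N) (𝒰 : Ultrafilter ℕ) {y w : ℕ → Z} {t : ℕ → ℝ≥0} {w₀ : Z}
    (h : ∀ n, π.segMem (t n) (y n) N) (ht : Tendsto t 𝒰 atTop)
    (hw : ∀ n, π.flow (t n) (y n) = some (w n)) (hw₀ : Tendsto w 𝒰 (𝓝 w₀)) :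
    ∃ v : ℝ≥0 → Z, v 0 = w₀ ∧ (∀ a, v a ∈ N) ∧
      ∀ a b, π.flow b (v (a + b)) = some (v a) := by
  choose p hp v hvN hv using fun a : ℝ≥0 => hN.exists_tendsto hNc 𝒰 (y := y)
    (t := fun n => t n - a) fun n s hs => h n s (hs.trans tsub_le_self)
  have h0 : v 0 = w₀ := by
    have : p 0 = w := by
      ext1 n
      have h1 := hp 0 n
      simp only [tsub_zero, hw, Option.some.injEq] at h1
      exact h1.symm
    exact tendsto_nhds_unique (this ▸ hv 0) hw₀
  refine ⟨v, h0, hvN, fun a b => ?_⟩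
  have hsplit : ∀ n, a + b ≤ t n → t n - (a + b) + b = t n - a := by
    intro n hn
    rw [← tsub_tsub, tsub_add_cancel_of_le]
    exact le_tsub_of_add_le_left hn
  have hev : ∀ᶠ n in (𝒰 : Filter ℕ), a + b ≤ t n := ht.eventually_ge_atTop _
  have hseg : π.segMem b (v (a + b)) N := by
    refine segMem_of_tendsto hNc hN.2 (hv (a + b)) ?_
    filter_upwards [hev] with n hn
    refine segMem.shift (s := t n - (a + b)) (z := y n) ?_ (hp (a + b) n)
    rw [hsplit n hn]
    exact fun s hs => h n s (hs.trans tsub_le_self)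
  obtain ⟨x, -, hx⟩ := hseg b le_rfl
  have : Tendsto (p a) 𝒰 (𝓝 x) := by
    refine tendsto_flow tendsto_const_nhds (hv (a + b)) hx ?_
    filter_upwards [hev] with n hn
    rw [← flow_add_of_flow (hp (a + b) n), hsplit n hn, hp a n]
  rw [hx, tendsto_nhds_unique this (hv a)]

/-- Gluing a backward solution and a forward orbit. -/
lemma mem_Inv_of_backward_forward {P : Set Z} {v : ℝ≥0 → Z} (hvP : ∀ a, v a ∈ P)
    (hv : ∀ a b, π.flow b (v (a + b)) = some (v a)) (hf : ∀ t, π.segMem t (v 0) P) :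
    v 0 ∈ π.Inv P := by
  choose f hfP hf using fun t => hf t t le_rfl
  have hf0 : f 0 = v 0 := by
    have := hf 0
    rw [π.flow_zero] at this
    simpa using this.symm
  refine ⟨fun t => if t ≤ 0 then v (-t).toNNReal else f t.toNNReal, ?_, ?_, by simp⟩
  · intro t₀ s
    by_cases h1 : t₀ + s ≤ 0
    · have h0 : t₀ ≤ 0 := by linarith [s.coe_nonneg]
      simp only [h1, h0, if_true]
      have h2 : (-t₀).toNNReal = (-(t₀ + s)).toNNReal + s := by
        rw [← NNReal.coe_inj, NNReal.coe_add, Real.coe_toNNReal _ (by linarith),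
          Real.coe_toNNReal _ (by linarith)]
        ring
      rw [h2, hv]
    · simp only [h1, if_false]
      by_cases h0 : t₀ ≤ 0
      · simp only [h0, if_true]
        have h2 : s = (-t₀).toNNReal + (t₀ + s).toNNReal := by
          rw [← NNReal.coe_inj, NNReal.coe_add, Real.coe_toNNReal _ (by linarith),
            Real.coe_toNNReal _ (by linarith)]
          ring
        have h3 := hv 0 (-t₀).toNNReal
        rw [zero_add] at h3
        conv_lhs => rw [h2]
        rw [flow_add_of_flow h3, hf]
      · simp only [h0, if_false]
        have h2 : (t₀ + s).toNNReal = t₀.toNNReal + s := by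
          rw [← NNReal.coe_inj, NNReal.coe_add, Real.coe_toNNReal _ (by linarith),
            Real.coe_toNNReal _ (by linarith)]
        rw [h2, ← flow_add_of_flow (hf t₀.toNNReal), hf]
  · intro t
    dsimp only
    split_ifs
    · exact hvP _
    · exact hfP _

lemma IsSolution.shift {u : ℝ → Z} (hu : π.IsSolution u) (c : ℝ) :
    π.IsSolution fun t => u (c + t) := by
  intro t₀ s
  rw [hu (c + t₀) s, add_assoc]

lemma IsSolution.segMem {u : ℝ → Z} (hu : π.IsSolution u) {M : Set Z} (hM : ∀ t, u t ∈ M)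
    (t₀ : ℝ) (s : ℝ≥0) : π.segMem s (u t₀) M := fun r _ => ⟨_, hM _, hu t₀ r⟩

lemma Inv_subset (N : Set Z) : π.Inv N ⊆ N := by
  rintro z ⟨u, -, huN, rfl⟩
  exact huN 0

lemma Inv_mono {M N : Set Z} (h : M ⊆ N) : π.Inv M ⊆ π.Inv N := by
  rintro z ⟨u, hu, huN, rfl⟩
  exact ⟨u, hu, fun t => h (huN t), rfl⟩

lemma exists_solution_Inv {N : Set Z} {z : Z} (hz : z ∈ π.Inv N) :
    ∃ u : ℝ → Z, π.IsSolution u ∧ (∀ t, u t ∈ π.Inv N) ∧ u 0 = z := by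
  obtain ⟨u, hu, huN, rfl⟩ := hz
  exact ⟨u, hu, fun t => ⟨fun s => u (t + s), hu.shift t, fun s => huN _, by simp⟩, rfl⟩

lemma segMem_Inv {N : Set Z} {z : Z} (hz : z ∈ π.Inv N) (t : ℝ≥0) :
    π.segMem t z (π.Inv N) := by
  obtain ⟨u, hu, huN, rfl⟩ := exists_solution_Inv hz
  exact hu.segMem huN 0 t

/-- The maximal invariant subset of a strongly admissible closed set is compact. -/
lemma StronglyAdmissible.isCompact_Inv {P : Set Z} (hP : π.StronglyAdmissible P)
    (hPc : IsClosed P) : IsCompact (π.Inv P) := by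
  apply IsSeqCompact.isCompact
  intro x hx
  choose u hu huP hux using hx
  have hflow : ∀ n : ℕ, π.flow (n : ℝ≥0) (u n (-(n : ℝ))) = some (x n) := by
    intro n
    rw [hu n, ← hux n]
    simp
  have hseg : ∀ n : ℕ, π.segMem (n : ℝ≥0) (u n (-(n : ℝ))) P := fun n =>
    (hu n).segMem (huP n) _ _
  obtain ⟨w, hw, l, hlP, hl⟩ := hP.exists_tendsto hPc (hyperfilter ℕ) hseg
  have hwx : w = x := by
    ext1 n
    have := hw n
    rw [hflow n] at this
    simpa using this.symm
  subst hwx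
  obtain ⟨v, hv0, hvP, hv⟩ := hP.exists_backward hPc (hyperfilter ℕ) hseg
    (tendsto_natCast_atTop_atTop.mono_left Nat.hyperfilter_le_atTop) hw hl
  refine ⟨l, ?_, ?_⟩
  · rw [← hv0] at hl ⊢
    refine mem_Inv_of_backward_forward hvP hv fun t => ?_
    refine segMem_of_tendsto hPc hP.2 hl (Eventually.of_forall fun n => ?_)
    rw [← hux n]
    exact (hu n).segMem (huP n) _ _
  · have hcl : MapClusterPt l atTop w :=
      (show MapClusterPt l (hyperfilter ℕ : Filter ℕ) w from hl.mapClusterPt).mono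
        Nat.hyperfilter_le_atTop
    exact hcl.tendsto_subseq

end LimitLemmas

end PartialSemiflow

namespace PartialSemiflow

section Tube

variable {Z : Type*} [MetricSpace Z] (π : PartialSemiflow Z)

/-- Points reached inside `U` from points of `H` at distance less than `δ` from `K`. -/
def tube (H K U : Set Z) (δ : ℝ) : Set Z :=
  {w | ∃ z ∈ H, (∃ k ∈ K, dist z k < δ) ∧ ∃ t, π.segMem t z U ∧ π.flow t z = some w}

variable {π} {H K U : Set Z}

lemma tube_mono {δ ε : ℝ} (h : δ ≤ ε) : π.tube H K U δ ⊆ π.tube H K U ε := by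
  rintro w ⟨z, hz, ⟨k, hk, hzk⟩, ht⟩
  exact ⟨z, hz, ⟨k, hk, hzk.trans_le h⟩, ht⟩

lemma closure_tube_subset (hHc : IsClosed H) (hH : ∀ z ∈ H, ∀ t w, π.flow t z = some w → w ∈ H)
    {δ : ℝ} : closure (π.tube H K U δ) ⊆ H := by
  refine closure_minimal ?_ hHc
  rintro w ⟨z, hz, -, t, -, hw⟩
  exact hH z hz t w hw

lemma mem_tube_of_flow {δ : ℝ} {z w : Z} {t : ℝ≥0} (hz : z ∈ π.tube H K U δ)
    (ht : π.segMem t z U) (hw : π.flow t z = some w) : w ∈ π.tube H K U δ := by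
  obtain ⟨x, hx, hxk, s, hs, hsz⟩ := hz
  exact ⟨x, hx, hxk, s + t, hs.concat hsz ht, by rw [flow_add_of_flow hsz, hw]⟩

lemma mem_closure_tube_of_flow (hU : IsOpen U) {δ : ℝ} {z w : Z} {t : ℝ≥0}
    (hz : z ∈ closure (π.tube H K U δ)) (ht : π.segMem t z U) (hw : π.flow t z = some w) :
    w ∈ closure (π.tube H K U δ) := by
  rw [mem_closure_iff] at hz ⊢
  intro O hO hwO
  obtain ⟨x, ⟨hx1, y, hyO, hxy⟩, hx2⟩ := hz _
    ((isOpen_setOf_segMem (π := π) hU t).inter (isOpen_setOf_mem_point (π := π) hO t))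
    ⟨ht, w, hwO, hw⟩
  exact ⟨y, hyO, mem_tube_of_flow hx2 hx1 hxy⟩

lemma segMem.inter_of_invariant (hH : ∀ z ∈ H, ∀ t w, π.flow t z = some w → w ∈ H)
    {z : Z} (hz : z ∈ H) {t : ℝ≥0} {M N : Set Z} (h : π.segMem t z M) (hMN : M ∩ H ⊆ N) :
    π.segMem t z N := by
  intro s hs
  obtain ⟨w, hw, hsw⟩ := h s hs
  exact ⟨w, hMN ⟨hw, hH z hz s w hsw⟩, hsw⟩

/-- Points of a thin tube around `K` inside the closed set `Q` uniformly leave `P'`, provided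
that no point of `K ∩ Q` stays in `P'` forever. -/
lemma exists_uniform_exit {N P P' Q : Set Z} (hN : π.StronglyAdmissible N) (hNc : IsClosed N)
    (hP : π.StronglyAdmissible P) (hNP : N ⊆ P) (hUN : U ∩ H ⊆ N)
    (hH : ∀ z ∈ H, ∀ t w, π.flow t z = some w → w ∈ H) (hKN : K = π.Inv N)
    (hKP : K = π.Inv P) (hP'P : P' ⊆ P) (hP'c : IsClosed P') (hQ : IsClosed Q)
    (hQK : ∀ k ∈ K, k ∈ Q → ¬ ∀ t, π.segMem t k P') :
    ∃ δ > 0, ∃ T : ℝ≥0, ∀ w ∈ closure (π.tube H K U δ), w ∈ Q → ¬ π.segMem T w P' := by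
  by_contra! hcon
  have hpos : ∀ n : ℕ, (0 : ℝ) < 1 / ((n : ℝ) + 1) := fun n => Nat.one_div_pos_of_nat
  choose w hw hwQ hwP using fun n : ℕ => hcon (1 / ((n : ℝ) + 1)) (hpos n) (n : ℝ≥0)
  choose w' hw' hww' using fun n : ℕ => Metric.mem_closure_iff.1 (hw n) _ (hpos n)
  choose z hz k t htU htw using hw'
  choose k hk hzk using k
  have hKc : IsCompact K := hKN ▸ hN.isCompact_Inv hNc
  have hle : (hyperfilter ℕ : Filter ℕ) ≤ atTop := Nat.hyperfilter_le_atTop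
  have hε : Tendsto (fun n : ℕ => 1 / ((n : ℝ) + 1)) (hyperfilter ℕ) (𝓝 0) :=
    tendsto_one_div_add_atTop_nhds_zero_nat.mono_left hle
  obtain ⟨w'', hw'', l, hlN, hl⟩ := hN.exists_tendsto hNc (hyperfilter ℕ) (y := z) (t := t)
    fun n => (htU n).inter_of_invariant hH (hz n) hUN
  have hww : w'' = w' := by
    ext1 n
    have := hw'' n
    rw [htw n] at this
    simpa using this.symm
  subst hww
  have hwl : Tendsto w (hyperfilter ℕ) (𝓝 l) :=
    (tendsto_iff_of_dist (squeeze_zero (fun _ => dist_nonneg) (fun n => (hww' n).le) hε)).2 hl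
  have hforward : ∀ c, π.segMem c l P' := by
    intro c
    refine segMem_of_tendsto hP'c (hP.mono hP'P).2 hwl ?_
    have : ∀ᶠ n : ℕ in hyperfilter ℕ, c ≤ (n : ℝ≥0) :=
      (tendsto_natCast_atTop_atTop.mono_left hle).eventually_ge_atTop c
    filter_upwards [this] with n hn s hs using hwP n s (hs.trans hn)
  refine hQK l ?_ (hQ.mem_of_tendsto hwl (Eventually.of_forall hwQ)) hforward
  by_cases ht : Tendsto t (hyperfilter ℕ) atTop
  · obtain ⟨v, hv0, hvN, hv⟩ := hN.exists_backward hNc (hyperfilter ℕ)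
      (fun n => (htU n).inter_of_invariant hH (hz n) hUN) ht htw hl
    rw [hKP, ← hv0]
    exact mem_Inv_of_backward_forward (fun a => hNP (hvN a)) hv fun c =>
      hv0 ▸ (hforward c).mono hP'P
  · rw [tendsto_atTop] at ht
    push Not at ht
    obtain ⟨c, hc⟩ := ht
    obtain ⟨t₀, -, ht₀⟩ := isCompact_iff_ultrafilter_le_nhds.1
      (isCompact_Icc (a := (0 : ℝ≥0)) (b := c)) ((hyperfilter ℕ).map t) (by
        refine le_principal_iff.2 (Ultrafilter.mem_coe.2 (Ultrafilter.mem_map.2 ?_))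
        filter_upwards [hc] with n hn using ⟨zero_le, hn.le⟩)
    obtain ⟨k₀, hk₀, hkk₀⟩ := isCompact_iff_ultrafilter_le_nhds.1 hKc ((hyperfilter ℕ).map k)
      (le_principal_iff.2 (Ultrafilter.mem_coe.2 (Ultrafilter.mem_map.2
        (Filter.univ_mem' hk))))
    have hzk₀ : Tendsto z (hyperfilter ℕ) (𝓝 k₀) :=
      (tendsto_iff_of_dist (squeeze_zero (fun _ => dist_nonneg) (fun n => (hzk n).le) hε)).2 hkk₀
    obtain ⟨x, hxK, hx⟩ := segMem_Inv (hKN ▸ hk₀) t₀ t₀ le_rfl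
    have := tendsto_flow (show Tendsto t (hyperfilter ℕ) (𝓝 t₀) from ht₀) hzk₀ hx
      (Eventually.of_forall htw)
    rw [tendsto_nhds_unique hl this, hKN]
    exact hxK

lemma exists_isOpen_inter_subset {W : Set Z} (h : ∀ k ∈ K, W ∈ 𝓝[H] k) :
    ∃ U, IsOpen U ∧ K ⊆ U ∧ U ∩ H ⊆ W := by
  choose! V hVo hV hVW using fun k hk => mem_nhdsWithin.1 (h k hk)
  refine ⟨⋃ k ∈ K, V k, isOpen_biUnion hVo, fun k hk => mem_biUnion hk (hV k hk), ?_⟩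
  rintro x ⟨hx, hxH⟩
  obtain ⟨k, hk, hxk⟩ := mem_iUnion₂.1 hx
  exact hVW k hk ⟨hxk, hxH⟩

/-- The last point of an orbit segment in a closed set lies outside its interior. -/
lemma exists_last_mem {O : Set Z} (hO : IsOpen O) {z : Z} {s t : ℝ≥0} (hst : s ≤ t)
    (hd : ∀ r ≤ t, (π.flow r z).isSome) (hs : π.mem s z (closure O))
    (ht : ¬ π.mem t z (closure O)) :
    ∃ r < t, ∃ w, π.flow r z = some w ∧ w ∈ closure O ∧
      ∀ q, r ≤ q → q ≤ t → π.mem q z Oᶜ := by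
  set S := Icc s t \ {r | π.mem r z (closure O)ᶜ}
  have hS : IsCompact S :=
    isCompact_Icc.diff (isOpen_setOf_mem_time isClosed_closure.isOpen_compl z)
  have hmem : ∀ r ≤ t, ¬ π.mem r z (closure O)ᶜ → π.mem r z (closure O) := by
    intro r hr h
    obtain ⟨w, hw⟩ := Option.isSome_iff_exists.1 (hd r hr)
    rw [mem_iff_of_flow hw] at h ⊢
    simpa using h
  obtain ⟨r, hrS, hr⟩ := hS.exists_isGreatest ⟨s, ⟨le_rfl, hst⟩, by
    obtain ⟨w, hw, hsw⟩ := hs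
    simpa [mem_iff_of_flow hsw] using hw⟩
  obtain ⟨w, hwO, hw⟩ := hmem r hrS.1.2 hrS.2
  have hrt : r < t := lt_of_le_of_ne hrS.1.2 fun h => ht (h ▸ hmem r hrS.1.2 hrS.2)
  have hafter : ∀ q, r < q → q ≤ t → π.mem q z (closure O)ᶜ := by
    intro q hrq hqt
    by_contra hq
    exact not_le_of_gt hrq (hr ⟨⟨hrS.1.1.trans hrq.le, hqt⟩, hq⟩)
  refine ⟨r, hrt, w, hw, hwO, fun q hrq hqt => ?_⟩
  rcases hrq.lt_or_eq with hrq | rfl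
  · exact (hafter q hrq hqt).mono (compl_subset_compl.2 subset_closure)
  · refine ⟨w, fun hw' => ?_, hw⟩
    have hnb := (isOpen_setOf_mem_time (π := π) hO z).mem_nhds
      (show π.mem r z O from ⟨w, hw', hw⟩)
    obtain ⟨q, hq, hqI⟩ := exists_Ico_subset_of_mem_nhds hnb ⟨t, hrt⟩
    obtain ⟨p, hrp, hpq⟩ := exists_between (lt_min hq hrt)
    obtain ⟨x, hx, hx'⟩ := hqI ⟨hrp.le, hpq.trans_le (min_le_left _ _)⟩
    exact (mem_iff_of_flow hx').1 (hafter p hrp (hpq.le.trans (min_le_right _ _)))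
      (subset_closure hx)

end Tube

end PartialSemiflow

namespace PartialSemiflow

section TripleExistence

variable {Z : Type*} [MetricSpace Z] {π : PartialSemiflow Z}

/-- Existence of small index triples whose exit points leave `P₁` and `P₂` in bounded time and
whose attractor part enters `W_A` or leaves `P₁` and `P₂` in bounded time. -/
lemma exists_small_triple {H K A R N P₁ P₂ W W_A : Set Z}
    (hHc : IsClosed H) (hH : ∀ z ∈ H, ∀ t w, π.flow t z = some w → w ∈ H)
    (hN : π.StronglyAdmissible N) (hNc : IsClosed N) (hKN : K = π.Inv N)
    (hNK : ∀ k ∈ K, N ∈ 𝓝[H] k)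
    (hP₁ : π.StronglyAdmissible P₁) (hP₁c : IsClosed P₁) (hNP₁ : N ⊆ P₁) (hKP₁ : K = π.Inv P₁)
    (hP₂ : π.StronglyAdmissible P₂) (hP₂c : IsClosed P₂) (hNP₂ : N ⊆ P₂) (hKP₂ : K = π.Inv P₂)
    (hWK : ∀ k ∈ K, W ∈ 𝓝[H] k)
    (hAK : A ⊆ K) (hRK : R ⊆ K) (hAR : Disjoint A R) (hAc : IsClosed A) (hRc : IsClosed R)
    (hA : ∀ a ∈ A, ∃ u : ℝ → Z, π.IsSolution u ∧ (∀ t, u t ∈ A) ∧ u 0 = a)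
    (hR : ∀ a ∈ R, ∃ u : ℝ → Z, π.IsSolution u ∧ (∀ t, u t ∈ R) ∧ u 0 = a)
    (hA_of : ∀ u : ℝ → Z, π.IsSolution u → (∀ t, u t ∈ K) → ∀ O, IsOpen O → R ⊆ O →
      (∀ t ≤ 0, u t ∉ O) → u 0 ∈ A)
    (hR_of : ∀ u : ℝ → Z, π.IsSolution u → (∀ t, u t ∈ K) → ∀ O, IsOpen O → A ⊆ O →
      (∀ t ≥ 0, u t ∉ O) → u 0 ∈ R)
    (hWA : ∀ a ∈ A, W_A ∈ 𝓝[H] a) :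
    ∃ (T : ℝ≥0) (E₁ E₂ E₃ N_A : Set Z), 0 < T ∧
      IsClosed E₁ ∧ IsClosed E₂ ∧ IsClosed E₃ ∧ E₃ ⊆ E₂ ∧ E₂ ⊆ E₁ ∧ E₁ ⊆ H ∧ E₁ ⊆ N ∧ E₁ ⊆ W ∧
      (∀ z ∈ E₁, ∀ t, ¬ π.mem t z E₁ → ∃ s ≤ t, π.mem s z E₃) ∧
      (∀ z ∈ E₂, ∀ t, ¬ π.mem t z E₂ → ∃ s ≤ t, π.mem s z E₃) ∧
      (∀ z ∈ E₃, ∀ t, ¬ π.mem t z E₃ → ∃ s ≤ t, ¬ π.mem s z E₁) ∧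
      (∀ k ∈ K, E₁ \ E₃ ∈ 𝓝[H] k) ∧ (∀ a ∈ A, E₂ \ E₃ ∈ 𝓝[H] a) ∧
      IsClosed N_A ∧ N_A ⊆ N ∧ E₂ ⊆ N_A ∧ A = π.Inv N_A ∧ (∀ a ∈ A, N_A ∈ 𝓝[H] a) ∧
      (∀ z ∈ E₃, ¬ π.segMem T z P₁ ∧ ¬ π.segMem T z P₂) ∧
      (∀ z ∈ E₂, (¬ π.segMem T z P₁ ∧ ¬ π.segMem T z P₂) ∨ ∃ s ≤ T, π.mem s z W_A) := by
  have hKc : IsCompact K := hKN ▸ hN.isCompact_Inv hNc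
  obtain ⟨U, hU, hKU, hUNW⟩ := exists_isOpen_inter_subset
    (fun k hk => inter_mem (hNK k hk) (hWK k hk))
  have hUN : U ∩ H ⊆ N := fun x hx => (hUNW hx).1
  obtain ⟨V, hV, hKV, hVU⟩ := normal_exists_closure_subset hKc.isClosed hU hKU
  obtain ⟨UA, hUA, hAUA, hUAW⟩ := exists_isOpen_inter_subset hWA
  obtain ⟨O, hO, hAO, hOcl⟩ := normal_exists_closure_subset hAc (hUA.inter hRc.isOpen_compl)
    (fun a ha => ⟨hAUA ha, fun h => hAR.le_bot ⟨ha, h⟩⟩)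
  have hexitV : ∀ P, π.StronglyAdmissible P → IsClosed P → N ⊆ P → K = π.Inv P →
      ∃ δ > 0, ∃ T : ℝ≥0, ∀ w ∈ closure (π.tube H K U δ), w ∈ Vᶜ → ¬ π.segMem T w P :=
    fun P hP hPc hNP hKP => exists_uniform_exit hN hNc hP hNP hUN hH hKN hKP subset_rfl hPc
      hV.isClosed_compl fun k hk hkV => absurd (hKV hk) hkV
  obtain ⟨δ₁, hδ₁, T₁, hT₁⟩ := hexitV P₁ hP₁ hP₁c hNP₁ hKP₁
  obtain ⟨δ₂, hδ₂, T₂, hT₂⟩ := hexitV P₂ hP₂ hP₂c hNP₂ hKP₂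
  obtain ⟨δ₃, hδ₃, T₃, hT₃⟩ := exists_uniform_exit (P' := N ∩ Oᶜ) (Q := closure O) hN hNc hN
    subset_rfl hUN hH hKN hKN inter_subset_left (hNc.inter hO.isClosed_compl) isClosed_closure
    (by
      intro k hk hkO hkP
      obtain ⟨u, hu, huK, rfl⟩ := exists_solution_Inv (hKN ▸ hk)
      rw [← hKN] at huK
      refine (hOcl hkO).2 (hR_of u hu huK O hO hAO fun t ht => ?_)
      obtain ⟨w, hw, hw'⟩ := hkP t.toNNReal _ le_rfl
      rw [hu 0, zero_add, Real.coe_toNNReal t ht, Option.some.injEq] at hw'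
      exact hw' ▸ hw.2)
  set δ := min δ₁ (min δ₂ δ₃)
  set T : ℝ≥0 := max (max T₁ 1) (max T₂ T₃)
  have hδ : 0 < δ := lt_min hδ₁ (lt_min hδ₂ hδ₃)
  have hTpos : 0 < T := one_pos.trans_le ((le_max_right _ _).trans (le_max_left _ _))
  set G := closure (π.tube H K U δ)
  have hsegT : ∀ {S S' : ℝ≥0} {w : Z} {P : Set Z}, S ≤ S' → ¬ π.segMem S w P →
      ¬ π.segMem S' w P := fun hS h h' => h fun s hs => h' s (hs.trans hS)
  replace hT₁ : ∀ w ∈ G, w ∉ V → ¬ π.segMem T w P₁ := fun w hw hwV =>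
    hsegT ((le_max_left _ _).trans (le_max_left _ _))
      (hT₁ w (closure_mono (tube_mono (min_le_left _ _)) hw) hwV)
  replace hT₂ : ∀ w ∈ G, w ∉ V → ¬ π.segMem T w P₂ := fun w hw hwV =>
    hsegT ((le_max_left _ _).trans (le_max_right _ _))
      (hT₂ w (closure_mono (tube_mono ((min_le_right _ _).trans (min_le_left _ _))) hw) hwV)
  replace hT₃ : ∀ w ∈ G, w ∈ closure O → ¬ π.segMem T w (N ∩ Oᶜ) := fun w hw hwO =>
    hsegT ((le_max_right _ _).trans (le_max_right _ _))
      (hT₃ w (closure_mono (tube_mono ((min_le_right _ _).trans (min_le_right _ _))) hw) hwO)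
  have hGH : G ⊆ H := closure_tube_subset hHc hH
  set U' := U \ closure O
  have hU' : IsOpen U' := hU.sdiff isClosed_closure
  set B := {z | π.segMem T z U}ᶜ
  set B' := {z | π.segMem T z U'}ᶜ
  have hB : IsClosed B := (isOpen_setOf_segMem hU T).isClosed_compl
  have hB' : IsClosed B' := (isOpen_setOf_segMem hU' T).isClosed_compl
  have hBB' : B ⊆ B' := fun z hz h => hz (h.mono sdiff_subset)
  set E₁ := G ∩ closure V
  have hE₁H : E₁ ⊆ H := fun z hz => hGH hz.1
  have hE₁U : E₁ ⊆ U := fun z hz => hVU hz.2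
  have hE₁N : E₁ ⊆ N := fun z hz => hUN ⟨hE₁U hz, hE₁H hz⟩
  set C := closure V ∩ H
  have hC : IsClosed C := isClosed_closure.inter hHc
  have hCU : C ⊆ U := fun z hz => hVU hz.1
  have hCne := (hN.mono (M := C) fun z hz => hUN ⟨hCU hz, hz.2⟩).2
  have hexit : ∀ z ∈ E₁, ∀ t, ¬ π.segMem t z C →
      ∃ s ≤ t, ∃ w, π.flow s z = some w ∧ π.segMem s z C ∧ w ∈ G ∧ w ∈ closure V ∧ w ∉ V := by
    intro z hz t ht
    obtain ⟨s, hst, w, hw, hs, hwV⟩ := exists_exit hC hV hCne ⟨hz.2, hE₁H hz⟩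
      (by
        rintro s ⟨w, hw, hsw⟩
        exact ⟨w, ⟨subset_closure hw, hH z (hE₁H hz) s w hsw⟩, hsw⟩) ht
    exact ⟨s, hst, w, hw, hs, mem_closure_tube_of_flow hU hz.1 (hs.mono hCU) hw,
      ((mem_iff_of_flow hw).1 (hs s le_rfl)).1, hwV⟩
  have hleaveU : ∀ w ∈ G, w ∉ V → w ∈ B := fun w hw hwV h =>
    hT₁ w hw hwV ((h.inter_of_invariant hH (hGH hw) hUN).mono hNP₁)
  have hexit₁ : ∀ z ∈ E₁, ∀ t, ¬ π.mem t z E₁ → ∃ s ≤ t, π.mem s z (E₁ ∩ B) := by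
    intro z hz t ht
    have hseg : ¬ π.segMem t z C := by
      intro h
      obtain ⟨w, hw, htw⟩ := h t le_rfl
      exact ht ⟨w, ⟨mem_closure_tube_of_flow hU hz.1 (h.mono hCU) htw, hw.1⟩, htw⟩
    obtain ⟨s, hst, w, hw, -, hwG, hwV, hwV'⟩ := hexit z hz t hseg
    exact ⟨s, hst, w, ⟨⟨hwG, hwV⟩, hleaveU w hwG hwV'⟩, hw⟩
  have hleave : ∀ z ∈ E₁ ∩ B, ¬ π.segMem (T + T) z P₁ ∧ ¬ π.segMem (T + T) z P₂ := by
    rintro z ⟨hz, hzB⟩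
    obtain ⟨s, hsT, w, hw, -, hwG, -, hwV⟩ := hexit z hz T fun h => hzB (h.mono hCU)
    have hle : s + T ≤ T + T := by gcongr
    exact ⟨hsegT hle fun h => hT₁ w hwG hwV (h.shift hw),
      hsegT hle fun h => hT₂ w hwG hwV (h.shift hw)⟩
  have hVnhds : ∀ k ∈ K, E₁ \ (E₁ ∩ B) ∈ 𝓝[H] k := by
    intro k hk
    obtain ⟨u, hu, huK, hu0⟩ := exists_solution_Inv (hKN ▸ hk)
    have hkB : k ∈ Bᶜ := by
      rw [compl_compl, ← hu0]
      exact hu.segMem (fun t => hKU (hKN ▸ huK t)) 0 T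
    filter_upwards [self_mem_nhdsWithin, mem_nhdsWithin_of_mem_nhds (hV.mem_nhds (hKV hk)),
      mem_nhdsWithin_of_mem_nhds (hB.isOpen_compl.mem_nhds hkB),
      mem_nhdsWithin_of_mem_nhds (Metric.ball_mem_nhds k hδ)] with z hzH hzV hzB hzk
    have hzU : π.segMem 0 z U := by
      intro s hs
      obtain rfl : s = 0 := le_antisymm hs zero_le
      exact mem_zero_iff.2 (hVU (subset_closure hzV))
    have hzT : z ∈ π.tube H K U δ := ⟨z, hzH, ⟨k, hk, hzk⟩, 0, hzU, π.flow_zero z⟩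
    have hzE : z ∈ E₁ := mem_inter (subset_closure hzT) (subset_closure hzV)
    exact mem_sdiff_of_mem hzE fun h => hzB h.2
  have hOB' : closure O ⊆ B' := fun z hz h => (mem_zero_iff.1 (h 0 zero_le)).2 hz
  have hRB' : R ⊆ B'ᶜ := by
    intro a ha
    obtain ⟨u, hu, huR, rfl⟩ := hR a ha
    rw [compl_compl]
    exact hu.segMem (M := U') (fun t => ⟨hKU (hRK (huR t)), fun h => (hOcl h).2 (huR t)⟩) 0 T
  refine ⟨T + T, E₁, E₁ ∩ B', E₁ ∩ B, N ∩ B', by positivity, isClosed_closure.inter isClosed_closure,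
    (isClosed_closure.inter isClosed_closure).inter hB',
    (isClosed_closure.inter isClosed_closure).inter hB, inter_subset_inter_right _ hBB',
    inter_subset_left, hE₁H, hE₁N, fun z hz => (hUNW ⟨hE₁U hz, hE₁H hz⟩).2, hexit₁, ?_, ?_,
    hVnhds, ?_, hNc.inter hB', inter_subset_left, inter_subset_inter_left _ hE₁N, ?_, ?_,
    hleave, ?_⟩
  · rintro z ⟨hz, hzB'⟩ t ht
    by_cases hE : π.segMem t z E₁
    · exfalso
      obtain ⟨x, hxE, hx⟩ := hE t le_rfl
      have hxU' : π.segMem T x U' := by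
        by_contra hcon
        exact ht ⟨x, ⟨hxE, hcon⟩, hx⟩
      have hall : π.segMem (t + T) z U := (hE.mono hE₁U).concat hx (hxU'.mono sdiff_subset)
      have htO : ¬ π.mem t z (closure O) := by
        rw [mem_iff_of_flow hx]
        exact (mem_zero_iff.1 (hxU' 0 zero_le)).2
      have hs : ∃ s ≤ t, π.mem s z (closure O) := by
        by_contra! hcon
        refine hzB' fun s hs => ?_
        rcases le_total s t with hst | hts
        · obtain ⟨w, hw, hsw⟩ := hE s hst
          exact ⟨w, ⟨hE₁U hw, fun h => hcon s hst ⟨w, h, hsw⟩⟩, hsw⟩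
        · obtain ⟨c, rfl⟩ := exists_add_of_le hts
          exact (mem_add_iff hx).2 (hxU' c (le_trans le_add_self hs))
      obtain ⟨s, hst, hsO⟩ := hs
      obtain ⟨r, hrt, w, hw, hwO, hrw⟩ := exists_last_mem hO hst
        (fun r hr => by
          obtain ⟨w, -, hw⟩ := hE r hr
          simp [hw]) hsO htO
      have hwG : w ∈ E₁ := (mem_iff_of_flow hw).1 (hE r hrt.le)
      refine hT₃ w hwG.1 hwO fun q hq => ?_
      have hqU : π.mem (r + q) z U := hall (r + q) (by gcongr)
      obtain ⟨y, hyU, hy⟩ := hqU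
      rw [flow_add_of_flow hw] at hy
      refine ⟨y, ⟨hUN ⟨hyU, hH w (hE₁H hwG) q y hy⟩, ?_⟩, hy⟩
      rw [← mem_iff_of_flow hy, ← mem_add_iff hw]
      rcases le_total (r + q) t with hqt | htq
      · exact hrw _ le_self_add hqt
      · obtain ⟨c, hc⟩ := exists_add_of_le htq
        rw [hc]
        have hcT : c ≤ T := by
          have h1 : t + c ≤ t + T := by rw [← hc]; gcongr
          exact (add_le_add_iff_left t).1 h1
        exact (mem_add_iff hx).2 ((hxU' c hcT).mono fun y hy h => hy.2 (subset_closure h))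
    · have : ∃ s ≤ t, ¬ π.mem s z E₁ := by
        by_contra! hcon
        exact hE hcon
      obtain ⟨s, hst, hs⟩ := this
      obtain ⟨r, hrs, hr⟩ := hexit₁ z hz s hs
      exact ⟨r, hrs.trans hst, hr⟩
  · rintro z ⟨hz, hzB⟩ t ht
    by_contra! hcon
    obtain ⟨w, hw, htw⟩ := hcon t le_rfl
    refine ht ⟨w, ⟨hw, fun h => hzB ?_⟩, htw⟩
    intro s hs
    exact (segMem.concat (fun s hs => (hcon s hs).mono hE₁U) htw h) s (hs.trans le_add_self)
  · intro a ha
    filter_upwards [hVnhds a (hAK ha), mem_nhdsWithin_of_mem_nhds (hO.mem_nhds (hAO ha))]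
      with z hz hzO
    exact ⟨⟨hz.1, hOB' (subset_closure hzO)⟩, hz.2⟩
  · refine Subset.antisymm (fun a ha => ?_) ?_
    · obtain ⟨u, hu, huA, rfl⟩ := hA a ha
      exact ⟨u, hu, fun t => ⟨Inv_subset N (hKN ▸ hAK (huA t)),
        hOB' (subset_closure (hAO (huA t)))⟩, rfl⟩
    · rintro z ⟨u, hu, huN, rfl⟩
      exact hA_of u hu (fun t => by
        rw [hKN]
        exact ⟨fun s => u (t + s), hu.shift t, fun s => (huN _).1, by simp⟩) B'ᶜ hB'.isOpen_compl hRB' fun t _ h => h (huN t).2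
  · intro a ha
    filter_upwards [hNK a (hAK ha), mem_nhdsWithin_of_mem_nhds (hO.mem_nhds (hAO ha))]
      with z hz hzO using ⟨hz, hOB' (subset_closure hzO)⟩
  · rintro z ⟨hz, hzB'⟩
    by_cases hzB : z ∈ B
    · exact Or.inl (hleave z ⟨hz, hzB⟩)
    · right
      have hzU : π.segMem T z U := not_not.1 hzB
      by_contra! hcon
      refine hzB' fun s hs => ?_
      obtain ⟨w, hw, hsw⟩ := hzU s hs
      exact ⟨w, ⟨hw, fun h => hcon s (hs.trans le_self_add)
        ⟨w, hUAW ⟨(hOcl h).1, hH z (hE₁H hz) s w hsw⟩, hsw⟩⟩, hsw⟩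

end TripleExistence

end PartialSemiflow

section ExtendedPhaseSpace

variable {X Y : Type*} [MetricSpace X] [MetricSpace Y] {σ : GlobalSemiflow Y}
  {π : PartialSemiflow (Y × X)} {y₀ : Y}

lemma continuous_rMap : Continuous (rMap (X := X) σ y₀) := by
  have h : Continuous fun p : ℝ≥0 × X => σ.trans p.1 y₀ :=
    σ.continuous_trans.comp (by fun_prop : Continuous fun p : ℝ≥0 × X => (p.1, y₀))
  exact h.prodMk continuous_snd

lemma isClosed_extSpace : IsClosed (extSpace (X := X) σ y₀) := isClosed_closure.prod isClosed_univ

lemma flow_mem_extSpace (hσπ : σ.IsSkewProduct π) :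
    ∀ z ∈ extSpace (X := X) σ y₀, ∀ t w, π.flow t z = some w → w ∈ extSpace σ y₀ := by
  rintro ⟨y, x⟩ ⟨hy, -⟩ t w hw
  refine ⟨?_, mem_univ _⟩
  rw [hσπ t y x w hw]
  have hc : Continuous (σ.trans t) :=
    σ.continuous_trans.comp (by fun_prop : Continuous fun y : Y => (t, y))
  refine map_mem_closure hc hy ?_
  rintro _ ⟨s, rfl⟩
  exact ⟨s + t, σ.trans_add s t y₀⟩

lemma flow_rMap_of_chi (hσπ : σ.IsSkewProduct π) {s : ℝ≥0} {p q : ℝ≥0 × X}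
    (h : chi σ π y₀ s p = some q) : π.flow s (rMap σ y₀ p) = some (rMap σ y₀ q) := by
  simp only [chi, Option.map_eq_some_iff] at h
  obtain ⟨w, hw, rfl⟩ := h
  have h1 := hσπ _ _ _ _ hw
  simp only [rMap, hw, Option.some.injEq]
  exact Prod.ext (by rw [h1, σ.trans_add]) rfl

lemma exists_chi_of_flow {s : ℝ≥0} {p : ℝ≥0 × X} {w : Y × X}
    (h : π.flow s (rMap σ y₀ p) = some w) : ∃ q, chi σ π y₀ s p = some q := by
  simp only [rMap] at h
  simp [chi, h]

lemma chiMem_preimage_iff (hσπ : σ.IsSkewProduct π) {s : ℝ≥0} {p : ℝ≥0 × X} {E : Set (Y × X)} :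
    chiMem σ π y₀ s p (rMap σ y₀ ⁻¹' E) ↔ π.mem s (rMap σ y₀ p) E := by
  constructor
  · rintro ⟨q, hq, h⟩
    exact ⟨_, hq, flow_rMap_of_chi hσπ h⟩
  · rintro ⟨w, hw, h⟩
    obtain ⟨q, hq⟩ := exists_chi_of_flow h
    have := flow_rMap_of_chi hσπ hq
    rw [h, Option.some.injEq] at this
    exact ⟨q, mem_preimage.2 (this ▸ hw), hq⟩

lemma chiMem.mono {s : ℝ≥0} {p : ℝ≥0 × X} {M N : Set (ℝ≥0 × X)} (h : chiMem σ π y₀ s p M)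
    (hMN : M ⊆ N) : chiMem σ π y₀ s p N := by
  obtain ⟨q, hq, h⟩ := h
  exact ⟨q, hMN hq, h⟩

/-- Pulling back a pair of closed sets in the extended phase space to an index pair. -/
lemma isIndexPair_preimage (hσπ : σ.IsSkewProduct π) {K E₁ E₂ N : Set (Y × X)}
    (hE : E₂ ⊆ E₁) (hE₁ : IsClosed E₁) (hE₂ : IsClosed E₂) (hEH : E₁ ⊆ extSpace σ y₀)
    (hexit : ∀ z ∈ E₁, ∀ t, ¬ π.mem t z E₁ → ∃ s ≤ t, π.mem s z E₂)
    (hinv : ∀ z ∈ E₂, ∀ t, ¬ π.mem t z E₂ → ∃ s ≤ t, ¬ π.mem s z E₁)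
    (hN : IsIsolatingNbhd σ π y₀ K N) (hNa : π.StronglyAdmissible N) (hEN : E₁ ⊆ N)
    (hK : ∀ k ∈ K, E₁ \ E₂ ∈ 𝓝[extSpace σ y₀] k) :
    IsIndexPair σ π y₀ K (rMap σ y₀ ⁻¹' E₁) (rMap σ y₀ ⁻¹' E₂) where
  toBasic :=
    { subset := preimage_mono hE
      closed₁ := hE₁.preimage continuous_rMap
      closed₂ := hE₂.preimage continuous_rMap
      ip2 := fun p hp t ht => by
        simp only [chiMem_preimage_iff hσπ] at ht ⊢
        exact hexit _ hp t ht
      ip3 := fun p hp t ht => by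
        simp only [chiMem_preimage_iff hσπ] at ht ⊢
        exact hinv _ hp t ht }
  ip4 := ⟨N, hN, hNa, fun _ hp => hEN hp.1⟩
  ip5 := ⟨E₁ \ E₂, ⟨sdiff_subset.trans hEH, hK⟩, subset_rfl⟩

/-- Points whose orbit leaves a set containing `r (N₁ \ N₂)` must hit the exit set `N₂`. -/
lemma IsBasicIndexPair.exists_chiMem_of_not_segMem (hσπ : σ.IsSkewProduct π)
    {N₁ N₂ : Set (ℝ≥0 × X)} (h : IsBasicIndexPair σ π y₀ N₁ N₂) {N : Set (Y × X)}
    (hN : N₁ \ N₂ ⊆ rMap σ y₀ ⁻¹' N) {p : ℝ≥0 × X} (hp : p ∈ N₁) {T : ℝ≥0}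
    (hT : ¬ π.segMem T (rMap σ y₀ p) N) : ∃ s ≤ T, chiMem σ π y₀ s p N₂ := by
  by_contra! hcon
  refine hT fun s hs => (chiMem_preimage_iff hσπ).1 ?_
  have h1 : chiMem σ π y₀ s p N₁ := by
    by_contra h2
    obtain ⟨r, hr, hr'⟩ := h.ip2 p hp s h2
    exact hcon r (hr.trans hs) hr'
  obtain ⟨q, hq, hpq⟩ := h1
  exact ⟨q, hN ⟨hq, fun hq₂ => hcon s hs ⟨q, hq₂, hpq⟩⟩, hpq⟩

lemma IsIsolatingNbhd.inter {K N M : Set (Y × X)} (hN : IsIsolatingNbhd σ π y₀ K N)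
    (hM : IsIsolatingNbhd σ π y₀ K M) : IsIsolatingNbhd σ π y₀ K (N ∩ M) := by
  have hK : K = π.Inv (N ∩ M) := by
    refine Subset.antisymm (fun k hk => ?_) ?_
    · obtain ⟨u, hu, huN, rfl⟩ := PartialSemiflow.exists_solution_Inv (hN.2.2.2 ▸ hk)
      rw [← hN.2.2.2] at huN
      exact ⟨u, hu, fun t => ⟨PartialSemiflow.Inv_subset _ (hN.2.2.2 ▸ huN t),
        PartialSemiflow.Inv_subset _ (hM.2.2.2 ▸ huN t)⟩, rfl⟩
    · exact (PartialSemiflow.Inv_mono inter_subset_left).trans hN.2.2.2.symm.subset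
  refine ⟨inter_subset_left.trans hN.1, hN.2.1.inter hM.2.1, fun z hz => ?_, hK⟩
  exact inter_mem (hN.2.2.1 z (PartialSemiflow.Inv_mono inter_subset_left hz))
    (hM.2.2.1 z (PartialSemiflow.Inv_mono inter_subset_right hz))

lemma solAlphaLimit_nonempty {K : Set (Y × X)} (hK : IsCompact K) {u : ℝ → Y × X}
    (hu : ∀ t, u t ∈ K) : (solAlphaLimit u).Nonempty := by
  obtain ⟨x, -, hx⟩ := hK.exists_mapClusterPt (f := (atBot : Filter ℝ)) (u := u)
    (tendsto_principal.2 (Eventually.of_forall hu))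
  refine ⟨x, mem_iInter.2 fun t => ?_⟩
  exact clusterPt_iff_forall_mem_closure.1 hx (u '' Iic t) (image_mem_map (Iic_mem_atBot t))

lemma solOmegaLimit_nonempty {K : Set (Y × X)} (hK : IsCompact K) {u : ℝ → Y × X}
    (hu : ∀ t, u t ∈ K) : (solOmegaLimit u).Nonempty := by
  obtain ⟨x, -, hx⟩ := hK.exists_mapClusterPt (f := (atTop : Filter ℝ)) (u := u)
    (tendsto_principal.2 (Eventually.of_forall hu))
  refine ⟨x, mem_iInter.2 fun t => ?_⟩
  exact clusterPt_iff_forall_mem_closure.1 hx (u '' Ici t) (image_mem_map (Ici_mem_atTop t))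

lemma IsARDecomp.mem_attractor {K A R : Set (Y × X)} (h : IsARDecomp σ π y₀ K A R)
    (hK : IsCompact K) {u : ℝ → Y × X} (hu : π.IsSolution u) (huK : ∀ t, u t ∈ K)
    {O : Set (Y × X)} (hO : IsOpen O) (hRO : R ⊆ O) (huO : ∀ t ≤ 0, u t ∉ O) : u 0 ∈ A := by
  rcases h.alternatives u hu huK with h1 | h1 | ⟨h1, -⟩
  · exact h1 0
  · exact absurd (hRO (h1 0)) (huO 0 le_rfl)
  · obtain ⟨x, hx⟩ := solAlphaLimit_nonempty hK huK
    have : closure (u '' Iic 0) ⊆ Oᶜ :=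
      closure_minimal (image_subset_iff.2 huO) hO.isClosed_compl
    exact absurd (hRO (h1 hx)) (this (mem_iInter.1 hx 0))

lemma IsARDecomp.mem_repeller {K A R : Set (Y × X)} (h : IsARDecomp σ π y₀ K A R)
    (hK : IsCompact K) {u : ℝ → Y × X} (hu : π.IsSolution u) (huK : ∀ t, u t ∈ K)
    {O : Set (Y × X)} (hO : IsOpen O) (hAO : A ⊆ O) (huO : ∀ t ≥ 0, u t ∉ O) : u 0 ∈ R := by
  rcases h.alternatives u hu huK with h1 | h1 | ⟨-, h1⟩
  · exact absurd (hAO (h1 0)) (huO 0 le_rfl)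
  · exact h1 0
  · obtain ⟨x, hx⟩ := solOmegaLimit_nonempty hK huK
    have : closure (u '' Ici 0) ⊆ Oᶜ :=
      closure_minimal (image_subset_iff.2 huO) hO.isClosed_compl
    exact absurd (hAO (h1 hx)) (this (mem_iInter.1 hx 0))

/-- An isolated invariant subset of `Inv N` is compact if `N` is closed and strongly admissible. -/
lemma IsIsolatingNbhd.isCompact_of_subset {R M N : Set (Y × X)} (hM : IsIsolatingNbhd σ π y₀ R M)
    (hN : π.StronglyAdmissible N) (hNc : IsClosed N) (hRN : R ⊆ N) : IsCompact R := by
  have hR : R = π.Inv (M ∩ N) := by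
    refine Subset.antisymm (fun k hk => ?_)
      ((PartialSemiflow.Inv_mono inter_subset_left).trans hM.2.2.2.symm.subset)
    obtain ⟨u, hu, huR, rfl⟩ := PartialSemiflow.exists_solution_Inv (hM.2.2.2 ▸ hk)
    exact ⟨u, hu, fun t => ⟨PartialSemiflow.Inv_subset _ (huR t),
      hRN (hM.2.2.2.symm ▸ huR t)⟩, rfl⟩
  rw [hR]
  exact (hN.mono inter_subset_right).isCompact_Inv (hM.2.1.inter hNc)

end ExtendedPhaseSpace

theorem statement_18 (σ : GlobalSemiflow Y) (π : PartialSemiflow (Y × X)) (hσπ : σ.IsSkewProduct π) (y₀ : Y)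
    (K A R : Set (Y × X))
    (hiso : ∃ N, IsIsolatingNbhd σ π y₀ K N ∧ π.StronglyAdmissible N)
    (hAR : IsARDecomp σ π y₀ K A R)
    (N₁ N₂ N₃ M₁ M₂ M₃ : Set (ℝ≥0 × X))
    (hNt : IsIndexTriple σ π y₀ K A R N₁ N₂ N₃)
    (hMt : IsIndexTriple σ π y₀ K A R M₁ M₂ M₃) :
    ∃ T : ℝ≥0, 0 < T ∧ ∃ L₁ L₂ L₃ : Set (ℝ≥0 × X),
      IsIndexTriple σ π y₀ K A R L₁ L₂ L₃ ∧
      L₁ ⊆ N₁ ∩ M₁ ∧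
      L₂ ⊆ backSet σ π y₀ N₁ N₂ T ∩ backSet σ π y₀ M₁ M₂ T ∧
      L₃ ⊆ backSet σ π y₀ N₁ N₃ T ∩ backSet σ π y₀ M₁ M₃ T := by
  obtain ⟨N, hNiso, hNadm, hN₁⟩ := hNt.pairK.ip4
  obtain ⟨M, hMiso, hMadm, hM₁⟩ := hMt.pairK.ip4
  obtain ⟨WN, hWN, hWN₁⟩ := hNt.pairK.ip5
  obtain ⟨WM, hWM, hWM₁⟩ := hMt.pairK.ip5
  obtain ⟨VN, hVN, hVN₂⟩ := hNt.pairA.ip5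
  obtain ⟨VM, hVM, hVM₂⟩ := hMt.pairA.ip5
  obtain ⟨NA, hNA⟩ := hAR.A_isolated
  obtain ⟨NR, hNR⟩ := hAR.R_isolated
  have hI := hNiso.inter hMiso
  have hIadm : π.StronglyAdmissible (N ∩ M) := hNadm.mono inter_subset_left
  have hKI : K ⊆ N ∩ M := hI.2.2.2.subset.trans (PartialSemiflow.Inv_subset _)
  have hKc : IsCompact K := by
    rw [hI.2.2.2]
    exact hIadm.isCompact_Inv hI.2.1
  obtain ⟨T, E₁, E₂, E₃, B, hT, hE₁, hE₂, hE₃, hE₃₂, hE₂₁, hE₁H, hE₁N, hE₁W, hexit₁, hexit₂, hinv,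
      hnK, hnA, hB, hBN, hE₂B, hAB, hBA, hleave, hhit⟩ :=
    PartialSemiflow.exists_small_triple (π := π) (H := extSpace σ y₀) (K := K) (A := A) (R := R)
      (N := N ∩ M) (P₁ := N) (P₂ := M) (W := WN ∩ WM) (W_A := VN ∩ VM)
      isClosed_extSpace (flow_mem_extSpace hσπ) hIadm hI.2.1 hI.2.2.2
      (hI.2.2.2 ▸ hI.2.2.1) hNadm hNiso.2.1 inter_subset_left hNiso.2.2.2 hMadm hMiso.2.1
      inter_subset_right hMiso.2.2.2 (fun k hk => inter_mem (hWN.2 k hk) (hWM.2 k hk))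
      hAR.A_subset hAR.R_subset hAR.disjoint
      (hNA.isCompact_of_subset hIadm hI.2.1 (hAR.A_subset.trans hKI)).isClosed
      (hNR.isCompact_of_subset hIadm hI.2.1 (hAR.R_subset.trans hKI)).isClosed
      (fun a ha => by
        rw [hNA.2.2.2] at ha ⊢
        exact PartialSemiflow.exists_solution_Inv ha)
      (fun a ha => by
        rw [hNR.2.2.2] at ha ⊢
        exact PartialSemiflow.exists_solution_Inv ha)
      (fun u hu huK O hO hRO huO => hAR.mem_attractor hKc hu huK hO hRO huO)
      (fun u hu huK O hO hAO huO => hAR.mem_repeller hKc hu huK hO hAO huO)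
      (fun a ha => inter_mem (hVN.2 a ha) (hVM.2 a ha))
  have hL₁ : rMap σ y₀ ⁻¹' E₁ ⊆ N₁ ∩ M₁ := fun p hp =>
    ⟨(hWN₁ (hE₁W hp).1).1, (hWM₁ (hE₁W hp).2).1⟩
  have hleaveN : ∀ p ∈ rMap σ y₀ ⁻¹' E₁, ¬ π.segMem T (rMap σ y₀ p) N →
      ∃ s ≤ T, chiMem σ π y₀ s p N₃ := fun p hp h =>
    hNt.pairK.toBasic.exists_chiMem_of_not_segMem hσπ hN₁ (hL₁ hp).1 h
  have hleaveM : ∀ p ∈ rMap σ y₀ ⁻¹' E₁, ¬ π.segMem T (rMap σ y₀ p) M →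
      ∃ s ≤ T, chiMem σ π y₀ s p M₃ := fun p hp h =>
    hMt.pairK.toBasic.exists_chiMem_of_not_segMem hσπ hM₁ (hL₁ hp).2 h
  refine ⟨T, hT, rMap σ y₀ ⁻¹' E₁, rMap σ y₀ ⁻¹' E₂, rMap σ y₀ ⁻¹' E₃,
    ⟨preimage_mono hE₃₂, preimage_mono hE₂₁, ?_, ?_⟩, hL₁, ?_, ?_⟩
  · exact isIndexPair_preimage hσπ (hE₃₂.trans hE₂₁) hE₁ hE₃ hE₁H hexit₁ hinv hI hIadm hE₁N hnK
  · refine isIndexPair_preimage hσπ hE₃₂ hE₂ hE₃ (hE₂₁.trans hE₁H) hexit₂ ?_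
      ⟨hBN.trans hI.1, hB, hAB ▸ hBA, hAB⟩ (hIadm.mono hBN) hE₂B hnA
    intro z hz t ht
    obtain ⟨s, hs, h⟩ := hinv z hz t ht
    exact ⟨s, hs, fun h' => h (h'.mono hE₂₁)⟩
  · intro p hp
    have hp₁ : p ∈ rMap σ y₀ ⁻¹' E₁ := hE₂₁ hp
    rcases hhit _ hp with ⟨h1, h2⟩ | ⟨s, hs, h⟩
    · obtain ⟨s, hs, h⟩ := hleaveN p hp₁ h1
      obtain ⟨r, hr, h'⟩ := hleaveM p hp₁ h2
      exact ⟨⟨(hL₁ hp₁).1, s, hs, h.mono hNt.sub32⟩, ⟨(hL₁ hp₁).2, r, hr, h'.mono hMt.sub32⟩⟩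
    · rw [← chiMem_preimage_iff hσπ] at h
      exact ⟨⟨(hL₁ hp₁).1, s, hs, h.mono fun q hq => (hVN₂ hq.1).1⟩,
        ⟨(hL₁ hp₁).2, s, hs, h.mono fun q hq => (hVM₂ hq.2).1⟩⟩
  · intro p hp
    have hp₁ : p ∈ rMap σ y₀ ⁻¹' E₁ := hE₂₁ (hE₃₂ hp)
    exact ⟨⟨(hL₁ hp₁).1, hleaveN p hp₁ (hleave _ hp).1⟩,
      ⟨(hL₁ hp₁).2, hleaveM p hp₁ (hleave _ hp).2⟩⟩

end
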